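/- arXiv:2202.08653 — 2 statements merged into one kernel-verified Lean document; each statement's English description precedes it below -/
import Mathlib

section
/- Let (S(t))_{t≥0} satisfy Assumption S. Let 0 ≤ T₁ ≤ T₂ and f ∈ L^S_+. Let u : [T₁,T₂] → L^S_+ satisfy: S(T₁)f ≤ u(T₁); sup_{t∈[T₁,T₂]} ‖u(t)‖_κ < ∞; Γ-limsup_{s→t} u(s) ≤ u(t) for all t ∈ [T₁,T₂]; and for every t ∈ [T₁,T₂): limsup_{h↓0} ‖((u(t+h) − u(t))/h)⁻‖_κ < ∞ and Γ-limsup_{h↓0} ( A_Γ⁺u(t) − (u(t+h) − u(t))/h ) ≤ 0. Then S(t)f ≤ u(t) pointwise for all t ∈ [T₁,T₂]. -/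
open Filter MeasureTheory Topology
open scoped ENNReal Topology

noncomputable section

def ecoe {X : Type*} (f : X → ℝ) : X → EReal := fun x => (f x : EReal)

variable {X : Type*} [MetricSpace X]

/-- membership in `C_κ` -/
def MemCk (κ : X → ℝ) (f : X → ℝ) : Prop :=
  Continuous f ∧ ∃ r : ℝ, ∀ x, |f x| * κ x ≤ r

/-- `‖f‖_κ ≤ r` -/
def CkBound (κ : X → ℝ) (r : ℝ) (f : X → ℝ) : Prop := ∀ x, |f x| * κ x ≤ r

/-- extended `κ`-norm of an `EReal`-valued function -/
def eknorm (κ : X → ℝ) (f : X → EReal) : ℝ≥0∞ :=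
  ⨆ x, (f x).abs * ENNReal.ofReal (κ x)

/-- positive part of an `EReal`-valued function -/
def epos {X : Type*} (f : X → EReal) : X → EReal := fun x => max (f x) 0

/-- membership in `U_κ` -/
def MemUk (κ : X → ℝ) (f : X → EReal) : Prop :=
  UpperSemicontinuous f ∧ (∀ x, f x < ⊤) ∧
    ∃ r : ℝ, ∀ x, max (f x) 0 * (κ x : EReal) ≤ (r : EReal)

/-- `Γ`-limsup of a sequence of functions -/
def gammaLimsup (f : ℕ → X → EReal) (x : X) : EReal :=
  ⨆ (u : ℕ → X) (_ : Tendsto u atTop (𝓝 x)),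
    Filter.limsup (fun n => f n (u n)) atTop

/-- `g = Γ-lim f_n` -/
def IsGammaLim (f : ℕ → X → EReal) (g : X → EReal) : Prop :=
  ∀ x : X,
    (∀ u : ℕ → X, Tendsto u atTop (𝓝 x) →
      Filter.limsup (fun n => f n (u n)) atTop ≤ g x) ∧
    (∃ u : ℕ → X, Tendsto u atTop (𝓝 x) ∧
      Tendsto (fun n => f n (u n)) atTop (𝓝 (g x)))

/-- `Γ`-limsup as `h ↓ 0` -/
def gammaLimsupZero (F : ℝ → X → EReal) (x : X) : EReal :=
  ⨆ (h : ℕ → ℝ) (_ : ∀ n, 0 < h n) (_ : Tendsto h atTop (𝓝 (0:ℝ))),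
    gammaLimsup (fun n => F (h n)) x

/-- `Γ`-limsup as `s → t`, `s ≥ 0` -/
def gammaLimsupAt (F : ℝ → X → EReal) (t : ℝ) (x : X) : EReal :=
  ⨆ (s : ℕ → ℝ) (_ : ∀ n, 0 ≤ s n) (_ : Tendsto s atTop (𝓝 t)),
    gammaLimsup (fun n => F (s n)) x

/-- Assumption S on a family of operators on `U_κ` -/
structure AssumptionS (κ : X → ℝ) (S : ℝ → (X → EReal) → (X → EReal)) : Prop where
  monotone : ∀ t, 0 ≤ t → ∀ f g, MemUk κ f → MemUk κ g →
    (∀ x, f x ≤ g x) → ∀ x, S t f x ≤ S t g x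
  convex : ∀ t, 0 ≤ t → ∀ f g, MemUk κ f → MemUk κ g → ∀ lam : ℝ, 0 ≤ lam → lam ≤ 1 →
    ∀ x, S t (fun y => (lam : EReal) * f y + ((1 - lam : ℝ) : EReal) * g y) x
      ≤ (lam : EReal) * S t f x + ((1 - lam : ℝ) : EReal) * S t g x
  zero : ∀ t, 0 ≤ t → ∀ x, S t (fun _ => (0 : EReal)) x = 0
  maps : ∀ t, 0 ≤ t → ∀ f, MemUk κ f → MemUk κ (S t f)
  contAbove : ∀ t, 0 ≤ t → ∀ (f : ℕ → X → EReal) (g : X → EReal),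
    (∀ n, MemUk κ (f n)) → MemUk κ g →
    (∀ x, Antitone fun n => f n x) → (∀ x, (⨅ n, f n x) = g x) →
    ∀ x, (⨅ n, S t (f n) x) = S t g x
  gammaUsc : ∀ t, 0 ≤ t → ∀ f, MemUk κ f →
    ∀ x, gammaLimsupAt (fun s => S s f) t x ≤ S t f x
  idZero : ∀ f, MemUk κ f → S 0 f = f
  bounded : ∀ r t : ℝ, 0 ≤ r → 0 ≤ t → ∃ C : ℝ≥0∞, C ≠ ⊤ ∧
    ∀ s, 0 ≤ s → s ≤ t → ∀ f : X → ℝ, MemCk κ f → CkBound κ r f →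
      eknorm κ (S s (ecoe f)) ≤ C

/-- an `EReal`-valued function which belongs to `C_κ` -/
def IsCk (κ : X → ℝ) (F : X → EReal) : Prop :=
  ∃ g : X → ℝ, MemCk κ g ∧ ∀ x, F x = (g x : EReal)

/-- the upper Lipschitz set `L^S_+` -/
def UpperLip (κ : X → ℝ) (S : ℝ → (X → EReal) → (X → EReal)) (f : X → ℝ) : Prop :=
  MemCk κ f ∧
  (∀ t, 0 ≤ t → IsCk κ (S t (ecoe f))) ∧
  (∀ s t, 0 ≤ s → 0 ≤ t → S (s + t) (ecoe f) = S s (S t (ecoe f))) ∧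
  ∃ h₀ > (0:ℝ), ∃ c ≥ (0:ℝ), ∀ h, 0 ≤ h → h ≤ h₀ → ∀ x,
    max (S h (ecoe f) x - (f x : EReal)) 0 * (κ x : EReal) ≤ ((c * h : ℝ) : EReal)

/-- the (two-sided) Lipschitz set `L^S` -/
def LipSet (κ : X → ℝ) (S : ℝ → (X → EReal) → (X → EReal)) (f : X → ℝ) : Prop :=
  MemCk κ f ∧
  (∀ t, 0 ≤ t → IsCk κ (S t (ecoe f))) ∧
  (∀ s t, 0 ≤ s → 0 ≤ t → S (s + t) (ecoe f) = S s (S t (ecoe f))) ∧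
  ∃ h₀ > (0:ℝ), ∃ c ≥ (0:ℝ), ∀ h, 0 ≤ h → h ≤ h₀ → ∀ x,
    (S h (ecoe f) x - (f x : EReal)).abs * ENNReal.ofReal (κ x) ≤ ENNReal.ofReal (c * h)

/-- difference quotient `(S(h)f - f)/h` -/
def diffQuot (S : ℝ → (X → EReal) → (X → EReal)) (f : X → ℝ) (h : ℝ) : X → EReal :=
  fun x => ((h⁻¹ : ℝ) : EReal) * (S h (ecoe f) x - (f x : EReal))

/-- the upper `Γ`-generator `A_Γ⁺` -/
def uppGen (S : ℝ → (X → EReal) → (X → EReal)) (f : X → ℝ) : X → EReal :=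
  fun x => gammaLimsupZero (fun h => diffQuot S f h) x

/-- `g = A_Γ f`, i.e. the `Γ`-limit of the difference quotients exists and equals `g` -/
def IsGammaDeriv (S : ℝ → (X → EReal) → (X → EReal)) (f : X → ℝ) (g : X → EReal) : Prop :=
  ∀ h : ℕ → ℝ, (∀ n, 0 < h n) → Tendsto h atTop (𝓝 (0:ℝ)) →
    IsGammaLim (fun n => diffQuot S f (h n)) g

/-- `g = Af` in the mixed topology -/
def MixedDeriv (κ : X → ℝ) (S : ℝ → (X → EReal) → (X → EReal)) (f : X → ℝ) (g : X → ℝ) : Prop :=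
  (∃ h₀ > (0:ℝ), ∃ r : ℝ, ∀ h, 0 < h → h ≤ h₀ → ∀ x,
      |h⁻¹ * ((S h (ecoe f) x).toReal - f x)| * κ x ≤ r) ∧
  ∀ K : Set X, IsCompact K → ∀ ε > (0:ℝ), ∃ h₀ > (0:ℝ), ∀ h, 0 < h → h ≤ h₀ → ∀ x ∈ K,
    |h⁻¹ * ((S h (ecoe f) x).toReal - f x) - g x| ≤ ε

/-- upper `ε`-parallel function -/
def parallel (κ : X → ℝ) (f : X → EReal) (ε : ℝ) : X → EReal :=
  fun x => (((κ x)⁻¹ : ℝ) : EReal) *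
    ((⨆ y ∈ Metric.closedBall x ε, max (f y * (κ y : EReal)) (((-ε⁻¹ : ℝ)) : EReal)) + (ε : EReal))

/-- upper semicontinuous envelope of the upper `ε`-parallel function -/
def parallelEnv (κ : X → ℝ) (f : X → EReal) (ε : ℝ) : X → EReal :=
  fun x => ⨅ (δ : ℝ) (_ : 0 < δ), ⨆ y ∈ Metric.closedBall x δ, parallel κ f ε y

end

noncomputable section

/-- truncation of an extended real to `ℝ≥0∞` -/
def erealToENNReal (x : EReal) : ℝ≥0∞ := if x = ⊤ then ⊤ else ENNReal.ofReal x.toReal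

/-- Lebesgue integral of an `EReal`-valued function on `(a,b]`, with values in `[-∞,∞]` -/
def eIntegral (a b : ℝ) (F : ℝ → EReal) : EReal :=
  ((∫⁻ s in Set.Ioc a b, erealToENNReal (max (F s) 0)) : ℝ≥0∞) -
  ((∫⁻ s in Set.Ioc a b, erealToENNReal (max (-F s) 0)) : ℝ≥0∞)

/-- convolution `f * μ` of an `EReal`-valued function with a measure -/
def econv {X : Type*} [NormedAddCommGroup X] [MeasurableSpace X]
    (μ : Measure X) (f : X → EReal) (x : X) : EReal :=
  ((∫⁻ y, erealToENNReal (max (f (x - y)) 0) ∂μ : ℝ≥0∞) : EReal) -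
  ((∫⁻ y, erealToENNReal (max (-f (x - y)) 0) ∂μ : ℝ≥0∞) : EReal)

/-- conjugate functional `φ*` -/
def dualConj {X : Type*} [MetricSpace X] [MeasurableSpace X]
    (κ : X → ℝ) (φ : (X → ℝ) → ℝ) (μ : Measure X) : EReal :=
  ⨆ f : {g : X → ℝ // MemCk κ g}, (((∫ x, f.1 x ∂μ) : ℝ) : EReal) - ((φ f.1 : ℝ) : EReal)

/-- the topology `σ(ca_κ⁺, C_κ)` on measures -/
def weakTopo {X : Type*} [MetricSpace X] [MeasurableSpace X] (κ : X → ℝ) :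
    TopologicalSpace (Measure X) :=
  TopologicalSpace.induced
    (fun μ => fun f : {g : X → ℝ // MemCk κ g} => ∫ x, f.1 x ∂μ) Pi.topologicalSpace

/-- `φ₁`, the extension of `φ` from `C_κ` to `U_κ` -/
def extUk {X : Type*} [MetricSpace X] (κ : X → ℝ) (φ : (X → ℝ) → ℝ) (f : X → EReal) : EReal :=
  ⨅ g : {g : X → ℝ // MemCk κ g ∧ ∀ x, f x ≤ (g x : EReal)}, ((φ g.1 : ℝ) : EReal)

end

/-- superlevel monotonicity lemma -/
lemma aux_mono (L : ℝ → ℝ) (a b : ℝ) (hab : a ≤ b)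
    (hstep : ∀ r, a ≤ r → r < b → ∃ r', r < r' ∧ r' ≤ b ∧ L r ≤ L r')
    (hleft : ∀ r, a ≤ r → r ≤ b → ∀ s : ℕ → ℝ, (∀ n, a ≤ s n) → (∀ n, s n ≤ r) →
      Tendsto s atTop (𝓝 r) → ∀ c, (∀ n, c ≤ L (s n)) → c ≤ L r) :
    L a ≤ L b := by
  set A : Set ℝ := {r | a ≤ r ∧ r ≤ b ∧ L a ≤ L r} with hA
  have hne : A.Nonempty := ⟨a, le_refl a, hab, le_refl _⟩
  have hbd : BddAbove A := ⟨b, fun r hr => hr.2.1⟩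
  obtain ⟨s, -, hs, hsA⟩ := exists_seq_tendsto_sSup hne hbd
  have h1 : a ≤ sSup A := le_csSup hbd ⟨le_refl a, hab, le_refl _⟩
  have h2 : sSup A ≤ b := csSup_le hne (fun r hr => hr.2.1)
  have h3 : L a ≤ L (sSup A) :=
    hleft _ h1 h2 s (fun n => (hsA n).1) (fun n => le_csSup hbd (hsA n)) hs _
      (fun n => (hsA n).2.2)
  rcases lt_or_eq_of_le h2 with h | h
  · obtain ⟨r', hr1, hr2, hr3⟩ := hstep _ h1 h
    have : r' ≤ sSup A := le_csSup hbd ⟨by linarith, hr2, by linarith⟩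
    linarith
  · rw [h] at h3; exact h3

lemma aux_real (F : ℝ → ℝ) (τ h1 C δ0 ε : ℝ) (hh1 : 0 < h1) (hδ0 : 0 < δ0) (hε : 0 < ε)
    (hLip : ∀ q r, τ - h1 ≤ q → q ≤ r → r ≤ τ → r - q ≤ δ0 → F r ≤ F q + C * (r - q))
    (hstep : ∀ h, 0 < h → h ≤ h1 → ∀ δ > 0, ∃ k, 0 < k ∧ k < δ ∧
      F (τ - h + k) - F (τ - h) ≤ k * ((F τ - F (τ - h)) / h - ε)) : False := by
  set L : ℝ → ℝ := fun r => (F τ - F r) / (τ - r) + ε * Real.log (τ - r) with hL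
  have key : ∀ b, τ - h1 ≤ b → b < τ → L (τ - h1) ≤ L b := by
    intro b hb1 hb2
    apply aux_mono L _ _ hb1
    · intro r hr1 hr2
      obtain ⟨k, hk0, hk1, hk⟩ := hstep (τ - r) (by linarith) (by linarith) (b - r) (by linarith)
      refine ⟨r + k, by linarith, by linarith, ?_⟩
      have e1 : τ - (τ - r) = r := by ring
      rw [e1] at hk
      have p1 : 0 < τ - r := by linarith
      have p2 : 0 < τ - (r + k) := by linarith
      have hlog : Real.log (τ - r) - Real.log (τ - (r + k)) ≤ k / (τ - (r + k)) := by
        rw [← Real.log_div p1.ne' p2.ne']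
        refine (Real.log_le_sub_one_of_pos (by positivity)).trans (le_of_eq ?_)
        field_simp; ring
      have hψ : (F τ - F r) / (τ - r) + ε * (k / (τ - (r + k)))
          ≤ (F τ - F (r + k)) / (τ - (r + k)) := by
        rw [le_div_iff₀ p2]
        have e2 : ((F τ - F r) / (τ - r) + ε * (k / (τ - (r + k)))) * (τ - (r + k))
          = (F τ - F r) / (τ - r) * (τ - r) - k * ((F τ - F r) / (τ - r)) + ε * k := by
          field_simp; ring
        rw [e2, div_mul_cancel₀ _ p1.ne']
        nlinarith
      have := mul_le_mul_of_nonneg_left hlog hε.le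
      simp only [hL]
      nlinarith
    · intro r hr1 hr2 s hs1 hs2 hs c hc
      have p1 : 0 < τ - r := by linarith
      have ht : Tendsto (fun n => (F τ - F r + C * (r - s n)) / (τ - s n)
          + ε * Real.log (τ - s n)) atTop
          (𝓝 ((F τ - F r + C * (r - r)) / (τ - r) + ε * Real.log (τ - r))) := by
        have hs' : Tendsto (fun n => τ - s n) atTop (𝓝 (τ - r)) := hs.const_sub τ
        refine Tendsto.add (Tendsto.div ?_ hs' p1.ne') ((hs'.log p1.ne').const_mul ε)
        exact (((hs.const_sub r).const_mul C).const_add _)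
      have e : (F τ - F r + C * (r - r)) / (τ - r) + ε * Real.log (τ - r) = L r := by
        simp [hL]
      rw [e] at ht
      refine ge_of_tendsto ht ?_
      have ev : ∀ᶠ n in atTop, r - δ0 < s n := hs.eventually (lt_mem_nhds (by linarith))
      filter_upwards [ev] with n hn
      refine (hc n).trans ?_
      simp only [hL]
      have := hLip (s n) r (by linarith [hs1 n]) (hs2 n) (by linarith) (by linarith)
      have p2 : 0 < τ - s n := by linarith [hs2 n]
      gcongr
      linarith
  have hlog : Tendsto (fun h => -(ε * Real.log h)) (𝓝[>] (0:ℝ)) atTop :=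
    tendsto_neg_atBot_atTop.comp (Real.tendsto_log_nhdsGT_zero.const_mul_atBot hε)
  have ev1 := hlog.eventually (eventually_gt_atTop (C - L (τ - h1)))
  have ev2 : ∀ᶠ h in 𝓝[>] (0:ℝ), h ∈ Set.Ioo 0 (min h1 δ0) :=
    Ioo_mem_nhdsGT (lt_min hh1 hδ0)
  obtain ⟨h, hh, hh2⟩ := (ev1.and ev2).exists
  have q1 : h < h1 := lt_of_lt_of_le hh2.2 (min_le_left _ _)
  have q2 : h < δ0 := lt_of_lt_of_le hh2.2 (min_le_right _ _)
  have h0 := hh2.1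
  have := key (τ - h) (by linarith) (by linarith)
  have l2 := hLip (τ - h) τ (by linarith) (by linarith) le_rfl (by linarith)
  have e1 : τ - (τ - h) = h := by ring
  rw [e1] at l2
  have : L (τ - h) ≤ C + ε * Real.log h := by
    simp only [hL, e1]
    have : (F τ - F (τ - h)) / h ≤ C := by rw [div_le_iff₀ h0]; linarith
    linarith
  linarith

/-- upper envelope -/
noncomputable def envl {X : Type*} [MetricSpace X] (φ : ℝ → X → EReal) (x : X) : EReal :=
  ⨅ (δ : ℝ) (_ : 0 < δ), ⨆ y ∈ Metric.ball x δ, φ δ y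

lemma envl_lt {X : Type*} [MetricSpace X] {φ : ℝ → X → EReal} {x : X} {c : EReal}
    (h : envl φ x < c) : ∃ δ > 0, ∃ c' < c, ∀ y ∈ Metric.ball x δ, φ δ y ≤ c' := by
  unfold envl at h
  simp only [iInf_lt_iff] at h
  obtain ⟨δ, hδ, h⟩ := h
  refine ⟨δ, hδ, _, h, fun y hy => ?_⟩
  exact le_iSup₂ (f := fun y (_ : y ∈ Metric.ball x δ) => φ δ y) y hy

lemma envl_le {X : Type*} [MetricSpace X] {φ : ℝ → X → EReal} {x : X} {c : EReal} {δ : ℝ}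
    (hδ : 0 < δ) (h : ∀ y ∈ Metric.ball x δ, φ δ y ≤ c) : envl φ x ≤ c :=
  (iInf₂_le δ hδ).trans (iSup₂_le h)

lemma envl_usc {X : Type*} [MetricSpace X] {φ : ℝ → X → EReal}
    (hφ : ∀ y, Monotone fun δ => φ δ y) : UpperSemicontinuous (envl φ) := by
  intro x c hc
  obtain ⟨δ, hδ, c', hc', h⟩ := envl_lt hc
  filter_upwards [Metric.ball_mem_nhds x (half_pos hδ)] with z hz
  refine lt_of_le_of_lt (envl_le (half_pos hδ) fun y hy => ?_) hc'
  refine (hφ y (by linarith : δ / 2 ≤ δ)).trans (h y ?_)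
  rw [Metric.mem_ball] at *
  linarith [dist_triangle y z x]

lemma envl_le_of {X : Type*} [MetricSpace X] {φ : ℝ → X → EReal}
    (hφ : ∀ y, Monotone fun δ => φ δ y) {B : X → ℝ} (hB : Continuous B) {δ : ℝ} (hδ : 0 < δ)
    (h : ∀ y, φ δ y ≤ (B y : EReal)) (x : X) : envl φ x ≤ (B x : EReal) := by
  refine le_of_forall_gt fun c hc => ?_
  obtain ⟨c', h1, h2⟩ := exists_between hc
  have hBc : Continuous fun y => (B y : EReal) := continuous_coe_real_ereal.comp hB
  have : ∀ᶠ y in 𝓝 x, (B y : EReal) < c' := hBc.continuousAt.eventually (gt_mem_nhds h1)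
  obtain ⟨δ', hδ', hb⟩ := Metric.eventually_nhds_iff_ball.1 this
  refine lt_of_le_of_lt (envl_le (lt_min hδ hδ') fun y hy => ?_) h2
  refine (hφ y (min_le_left δ δ')).trans ((h y).trans (hb y ?_).le)
  exact Metric.ball_subset_ball (min_le_right _ _) hy

lemma le_envl {X : Type*} [MetricSpace X] {φ : ℝ → X → EReal} {x : X} {c : EReal}
    (h : ∀ δ, 0 < δ → c ≤ φ δ x) : c ≤ envl φ x :=
  le_iInf₂ fun δ hδ => (h δ hδ).trans
    (le_iSup₂ (f := fun y (_ : y ∈ Metric.ball x δ) => φ δ y) x (Metric.mem_ball_self hδ))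

/-- converting the sequential Γ-limsup into a local uniform bound -/
lemma gamma_local {X : Type*} [MetricSpace X] {f : ℕ → X → EReal} {x : X} {c : EReal}
    (h : gammaLimsup f x < c) :
    ∃ δ > 0, ∃ N : ℕ, ∀ n ≥ N, ∀ y ∈ Metric.ball x δ, f n y ≤ c := by
  by_contra! hcon
  have hf : ∀ m : ℕ, ∃ᶠ n in atTop, ∃ y ∈ Metric.ball x (1 / ((m:ℝ) + 1)), c < f n y := by
    intro m
    rw [frequently_atTop]
    intro N
    exact hcon _ (by positivity) N
  obtain ⟨φ, hφ, hp⟩ := extraction_forall_of_frequently hf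
  choose y hy hcy using hp
  set w : ℕ → X := Function.extend φ y (fun _ => x) with hw
  have hwφ : ∀ m, w (φ m) = y m := fun m => hφ.injective.extend_apply _ _ _
  have hwt : Tendsto w atTop (𝓝 x) := by
    rw [Metric.tendsto_atTop]
    intro η hη
    obtain ⟨M, hM⟩ := exists_nat_one_div_lt hη
    refine ⟨φ M, fun n hn => ?_⟩
    by_cases hn' : ∃ m, φ m = n
    · obtain ⟨m, rfl⟩ := hn'
      rw [hwφ]
      have hMm : M ≤ m := hφ.le_iff_le.1 hn
      refine lt_trans (Metric.mem_ball.1 (hy m)) (lt_of_le_of_lt ?_ hM)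
      exact Nat.one_div_le_one_div hMm
    · rw [hw, Function.extend_apply' _ _ _ hn']
      simpa using hη
  have h1 : limsup (fun n => f n (w n)) atTop ≤ gammaLimsup f x :=
    le_iSup₂ (f := fun (u : ℕ → X) (_ : Tendsto u atTop (𝓝 x)) =>
      limsup (fun n => f n (u n)) atTop) w hwt
  have h2 : c ≤ limsup (fun n => f n (w n)) atTop := by
    refine le_limsup_of_frequently_le ?_
    rw [frequently_atTop]
    intro N
    exact ⟨φ N, hφ.id_le N, by rw [hwφ]; exact (hcy N).le⟩
  exact absurd h (not_lt.2 (h2.trans h1))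

/-- real-valued members of `U_κ` -/
def RU {X : Type*} [MetricSpace X] (κ : X → ℝ) (a : X → ℝ) : Prop :=
  UpperSemicontinuous a ∧ ∃ r, 0 ≤ r ∧ ∀ x, a x * κ x ≤ r

lemma memUk_of_le {X : Type*} [MetricSpace X] {κ : X → ℝ} (hκ : ∀ x, 0 < κ x)
    {f : X → EReal} (hf : UpperSemicontinuous f) {r : ℝ} (hr : 0 ≤ r)
    (h : ∀ x, f x ≤ ((r / κ x : ℝ) : EReal)) : MemUk κ f := by
  refine ⟨hf, fun x => (h x).trans_lt (EReal.coe_lt_top _), r, fun x => ?_⟩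
  have h1 : max (f x) 0 ≤ ((r / κ x : ℝ) : EReal) :=
    max_le (h x) (by exact_mod_cast div_nonneg hr (hκ x).le)
  refine (mul_le_mul_of_nonneg_right h1 (by exact_mod_cast (hκ x).le)).trans (le_of_eq ?_)
  rw [← EReal.coe_mul, div_mul_cancel₀ _ (hκ x).ne']

lemma ecoe_usc {X : Type*} [MetricSpace X] {a : X → ℝ} (h : UpperSemicontinuous a) :
    UpperSemicontinuous (ecoe a) :=
  continuous_coe_real_ereal.comp_upperSemicontinuous h EReal.coe_strictMono.monotone

lemma RU.memUk {X : Type*} [MetricSpace X] {κ : X → ℝ} (hκ : ∀ x, 0 < κ x) {a : X → ℝ}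
    (h : RU κ a) : MemUk κ (ecoe a) := by
  obtain ⟨h1, r, hr, h2⟩ := h
  refine memUk_of_le hκ (ecoe_usc h1) hr fun x => ?_
  have : a x ≤ r / κ x := by rw [le_div_iff₀ (hκ x)]; exact h2 x
  exact EReal.coe_le_coe_iff.2 this

lemma RU.add {X : Type*} [MetricSpace X] {κ : X → ℝ} {a b : X → ℝ}
    (ha : RU κ a) (hb : RU κ b) : RU κ (fun x => a x + b x) := by
  obtain ⟨h1, r, hr, h2⟩ := ha
  obtain ⟨h1', r', hr', h2'⟩ := hb
  exact ⟨h1.add h1', r + r', by positivity, fun x => by nlinarith [h2 x, h2' x]⟩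

lemma RU.smul {X : Type*} [MetricSpace X] {κ : X → ℝ} {a : X → ℝ}
    (ha : RU κ a) {l : ℝ} (hl : 0 ≤ l) : RU κ (fun x => l * a x) := by
  obtain ⟨h1, r, hr, h2⟩ := ha
  refine ⟨?_, l * r, by positivity, fun x => by nlinarith [h2 x]⟩
  exact (continuous_const_mul l).comp_upperSemicontinuous h1 (monotone_mul_left_of_nonneg hl)

lemma MemCk.ru {X : Type*} [MetricSpace X] {κ : X → ℝ} (hκ : ∀ x, 0 < κ x) {a : X → ℝ}
    (ha : MemCk κ a) : RU κ a := by
  obtain ⟨h1, r, h2⟩ := ha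
  refine ⟨h1.upperSemicontinuous, |r|, abs_nonneg r, fun x => ?_⟩
  have := mul_le_mul_of_nonneg_right (le_abs_self (a x)) (hκ x).le
  linarith [h2 x, le_abs_self r]

lemma MemCk.add {X : Type*} [MetricSpace X] {κ : X → ℝ} (hκ : ∀ x, 0 < κ x) {a b : X → ℝ}
    (ha : MemCk κ a) (hb : MemCk κ b) : MemCk κ (fun x => a x + b x) := by
  obtain ⟨h1, r, h2⟩ := ha
  obtain ⟨h1', r', h2'⟩ := hb
  refine ⟨h1.add h1', r + r', fun x => ?_⟩
  have := mul_le_mul_of_nonneg_right (abs_add_le (a x) (b x)) (hκ x).le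
  linarith [h2 x, h2' x]

lemma MemCk.smul {X : Type*} [MetricSpace X] {κ : X → ℝ} {a : X → ℝ}
    (ha : MemCk κ a) (l : ℝ) : MemCk κ (fun x => l * a x) := by
  obtain ⟨h1, r, h2⟩ := ha
  refine ⟨h1.const_mul l, |l| * r, fun x => ?_⟩
  rw [abs_mul, mul_assoc]
  exact mul_le_mul_of_nonneg_left (h2 x) (abs_nonneg l)

lemma memCk_div {X : Type*} [MetricSpace X] {κ : X → ℝ} (hκc : Continuous κ)
    (hκ : ∀ x, 0 < κ x) (c : ℝ) : MemCk κ (fun x => c / κ x) := by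
  refine ⟨continuous_const.div hκc fun x => (hκ x).ne', |c|, fun x => ?_⟩
  rw [abs_div, abs_of_pos (hκ x), div_mul_cancel₀ _ (hκ x).ne']

/-- convexity and monotonicity, in real terms -/
lemma conv_le {X : Type*} [MetricSpace X] {κ : X → ℝ} (hκ : ∀ x, 0 < κ x)
    {S : ℝ → (X → EReal) → (X → EReal)} (hS : AssumptionS κ S) {t : ℝ} (ht : 0 ≤ t)
    {a b c : X → ℝ} (ha : RU κ a) (hb : RU κ b) (hc : RU κ c) {l : ℝ} (hl : 0 ≤ l) (hl1 : l ≤ 1)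
    (h : ∀ y, c y ≤ l * a y + (1 - l) * b y) {x : X} {A B : ℝ}
    (hA : S t (ecoe a) x ≤ (A : EReal)) (hB : S t (ecoe b) x ≤ (B : EReal)) :
    S t (ecoe c) x ≤ ((l * A + (1 - l) * B : ℝ) : EReal) := by
  have hl' : 0 ≤ 1 - l := by linarith
  have hcomb := (ha.smul hl).add (hb.smul hl')
  have e : (fun y => (l : EReal) * ecoe a y + ((1 - l : ℝ) : EReal) * ecoe b y)
      = ecoe (fun y => l * a y + (1 - l) * b y) := by
    funext y; simp only [ecoe]; push_cast; rfl
  have h1 := hS.convex t ht _ _ (ha.memUk hκ) (hb.memUk hκ) l hl hl1 x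
  rw [e] at h1
  have h0 := hS.monotone t ht _ _ (hc.memUk hκ) (hcomb.memUk hκ)
    (fun y => by simp only [ecoe]; exact_mod_cast h y) x
  refine h0.trans (h1.trans ?_)
  push_cast
  have p1 : (0 : EReal) ≤ (l : EReal) := by exact_mod_cast hl
  have p2 : (0 : EReal) ≤ (1 - l : EReal) := by exact_mod_cast hl'
  exact add_le_add (mul_le_mul_of_nonneg_left hA p1) (mul_le_mul_of_nonneg_left hB p2)

/-- Γ-lemma -/
lemma gamma_lemma {X : Type*} [MetricSpace X] {κ : X → ℝ} (hκc : Continuous κ)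
    (hκ : ∀ x, 0 < κ x)
    {S : ℝ → (X → EReal) → (X → EReal)} (hS : AssumptionS κ S)
    {f : ℕ → X → EReal} {F : X → EReal} (hf : ∀ n, MemUk κ (f n)) (hF : MemUk κ F)
    {r : ℝ} (hr : 0 ≤ r) (hb : ∀ n x, f n x ≤ ((r / κ x : ℝ) : EReal))
    (hloc : ∀ x c, F x < c → ∃ δ > 0, ∃ N : ℕ, ∀ n ≥ N, ∀ y ∈ Metric.ball x δ, f n y ≤ c)
    {τ : ℕ → ℝ} {t : ℝ} (hτ : ∀ n, 0 ≤ τ n) (ht : 0 ≤ t) (hτt : Tendsto τ atTop (𝓝 t))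
    {x : X} {c : EReal} (hc : S t F x < c) : ∀ᶠ n in atTop, S (τ n) (f n) x < c := by
  set g : ℕ → X → EReal := fun m => envl (fun _ y => ⨆ n ≥ m, f n y) with hg
  have hmono : ∀ m : ℕ, ∀ y, Monotone fun _ : ℝ => ⨆ n ≥ m, f n y :=
    fun m y => monotone_const
  have hBc : Continuous fun x => r / κ x := continuous_const.div hκc fun x => (hκ x).ne'
  have hgle : ∀ m x, g m x ≤ ((r / κ x : ℝ) : EReal) := fun m x =>
    envl_le_of (hmono m) hBc one_pos (fun y => iSup₂_le fun n _ => hb n y) x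
  have hgU : ∀ m, MemUk κ (g m) := fun m => memUk_of_le hκ (envl_usc (hmono m)) hr (hgle m)
  have hanti : ∀ x, Antitone fun m => g m x := by
    intro x m m' hmm
    refine le_iInf₂ fun δ hδ => (iInf₂_le δ hδ).trans ?_
    exact iSup₂_mono fun y hy => iSup₂_le fun n hn =>
      le_iSup₂ (f := fun n (_ : n ≥ m) => f n y) n (le_trans hmm hn)
  set G : X → EReal := fun x => ⨅ m, g m x with hG
  have hGU : MemUk κ G := by
    refine memUk_of_le hκ ?_ hr fun x => (iInf_le _ 0).trans (hgle 0 x)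
    exact upperSemicontinuous_iInf fun m => (hgU m).1
  have hGF : ∀ x, G x ≤ F x := by
    intro x
    refine le_of_forall_gt fun c hc => ?_
    obtain ⟨c', h1, h2⟩ := exists_between hc
    obtain ⟨δ, hδ, N, hN⟩ := hloc x c' h1
    refine lt_of_le_of_lt ((iInf_le _ N).trans (envl_le hδ fun y hy => ?_)) h2
    exact iSup₂_le fun n hn => hN n hn y hy
  have h1 : (⨅ m, S t (g m) x) < c := by
    rw [hS.contAbove t ht g G hgU hGU hanti (fun _ => rfl) x]
    exact (hS.monotone t ht _ _ hGU hF hGF x).trans_lt hc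
  obtain ⟨m, hm⟩ := iInf_lt_iff.1 h1
  have h2 : limsup (fun n => S (τ n) (g m) x) atTop < c := by
    refine lt_of_le_of_lt ?_ hm
    refine le_trans ?_ (hS.gammaUsc t ht (g m) (hgU m) x)
    unfold gammaLimsupAt
    refine le_iSup_of_le τ (le_iSup_of_le hτ (le_iSup_of_le hτt ?_))
    unfold gammaLimsup
    exact le_iSup₂_of_le (fun _ => x) tendsto_const_nhds le_rfl
  filter_upwards [eventually_lt_of_limsup_lt h2, eventually_ge_atTop m] with n hn hmn
  refine lt_of_le_of_lt (hS.monotone _ (hτ n) _ _ (hf n) (hgU m) (fun y => ?_) x) hn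
  exact le_envl fun δ _ => le_iSup₂ (f := fun n (_ : n ≥ m) => f n y) n hmn

/-- real-term form of S4 -/
lemma s4 {X : Type*} [MetricSpace X] {κ : X → ℝ} (hκ : ∀ x, 0 < κ x)
    {S : ℝ → (X → EReal) → (X → EReal)} (hS : AssumptionS κ S) (r t : ℝ) (ht : 0 ≤ t) (x : X) :
    ∃ C : ℝ, 0 ≤ C ∧ ∀ s, 0 ≤ s → s ≤ t → ∀ f : X → ℝ, MemCk κ f → CkBound κ r f →
      ∃ v : ℝ, S s (ecoe f) x = (v : EReal) ∧ |v| ≤ C := by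
  obtain ⟨C, hC, h⟩ := hS.bounded (max r 0) t (le_max_right _ _) ht
  refine ⟨C.toReal / κ x, div_nonneg ENNReal.toReal_nonneg (hκ x).le, fun s hs hst f hf hfr => ?_⟩
  have h1 := h s hs hst f hf (fun y => (hfr y).trans (le_max_left _ _))
  have h2 : (S s (ecoe f) x).abs * ENNReal.ofReal (κ x) ≤ C :=
    (le_iSup (fun x => (S s (ecoe f) x).abs * ENNReal.ofReal (κ x)) x).trans h1
  have hk : ENNReal.ofReal (κ x) ≠ 0 := by simpa using hκ x
  generalize S s (ecoe f) x = z at h2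
  induction z with
  | bot => rw [EReal.abs_bot, ENNReal.top_mul hk] at h2; exact absurd (top_le_iff.1 h2) hC
  | top => rw [EReal.abs_top, ENNReal.top_mul hk] at h2; exact absurd (top_le_iff.1 h2) hC
  | coe v =>
    refine ⟨v, rfl, ?_⟩
    rw [EReal.abs_def, ← ENNReal.ofReal_mul (abs_nonneg v)] at h2
    rw [le_div_iff₀ (hκ x)]
    exact (ENNReal.ofReal_le_iff_le_toReal hC).1 h2

lemma ereal_between {a : ℝ} {c : EReal} (h : (a : EReal) < c) :
    ∃ w : ℝ, a < w ∧ (w : EReal) < c := by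
  obtain ⟨w, h1, h2⟩ := EReal.lt_iff_exists_real_btwn.1 h
  exact ⟨w, by exact_mod_cast h1, h2⟩

/-- the usc version of the upper generator -/
noncomputable def At {X : Type*} [MetricSpace X] (S : ℝ → (X → EReal) → (X → EReal))
    (g : X → ℝ) : X → EReal :=
  envl fun δ y => ⨆ k ∈ Set.Ioo (0:ℝ) δ, diffQuot S g k y

lemma At_mono {X : Type*} [MetricSpace X] (S : ℝ → (X → EReal) → (X → EReal))
    (g : X → ℝ) (y : X) : Monotone fun δ : ℝ => ⨆ k ∈ Set.Ioo (0:ℝ) δ, diffQuot S g k y := by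
  intro δ δ' h
  exact biSup_mono fun k hk => ⟨hk.1, hk.2.trans_le h⟩

lemma At_le_uppGen {X : Type*} [MetricSpace X] (S : ℝ → (X → EReal) → (X → EReal))
    (g : X → ℝ) (y : X) : At S g y ≤ uppGen S g y := by
  refine le_of_forall_lt fun c hc => ?_
  obtain ⟨c', h1, h2⟩ := exists_between hc
  refine h1.trans_le ?_
  have hn : ∀ n : ℕ, ∃ z ∈ Metric.ball y (1 / ((n:ℝ) + 1)), ∃ k ∈ Set.Ioo (0:ℝ) (1 / ((n:ℝ) + 1)),
      c' < diffQuot S g k z := by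
    intro n
    have : c' < ⨆ z ∈ Metric.ball y (1 / ((n:ℝ) + 1)),
        ⨆ k ∈ Set.Ioo (0:ℝ) (1 / ((n:ℝ) + 1)), diffQuot S g k z :=
      h2.trans_le (iInf₂_le (1 / ((n:ℝ) + 1)) (by positivity))
    simp only [lt_iSup_iff] at this
    obtain ⟨z, hz, k, hk, h⟩ := this
    exact ⟨z, hz, k, hk, h⟩
  choose z hz k hk hzk using hn
  have hk0 : Tendsto k atTop (𝓝 0) :=
    squeeze_zero (fun n => (hk n).1.le) (fun n => (hk n).2.le) tendsto_one_div_add_atTop_nhds_zero_nat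
  have hz0 : Tendsto z atTop (𝓝 y) := by
    rw [tendsto_iff_dist_tendsto_zero]
    exact squeeze_zero (fun n => dist_nonneg) (fun n => (Metric.mem_ball.1 (hz n)).le)
      tendsto_one_div_add_atTop_nhds_zero_nat
  unfold uppGen gammaLimsupZero
  refine le_iSup_of_le k (le_iSup_of_le (fun n => (hk n).1) (le_iSup_of_le hk0 ?_))
  unfold gammaLimsup
  refine le_iSup₂_of_le z hz0 ?_
  exact le_limsup_of_frequently_le (Frequently.of_forall fun n => (hzk n).le)

lemma key_step {X : Type*} [MetricSpace X] {κ : X → ℝ} (hκc : Continuous κ)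
    (hκ : ∀ x, 0 < κ x)
    {S : ℝ → (X → EReal) → (X → EReal)} (hS : AssumptionS κ S)
    (g : X → ℝ) (hg : UpperLip κ S g) (τ hm : ℝ) (hhm : 0 < hm) (hmτ : hm ≤ τ)
    (b : ℝ → X → ℝ) (r : ℝ) (hbC : ∀ h, 0 < h → h ≤ hm → MemCk κ (b h))
    (hbr : ∀ h, 0 < h → h ≤ hm → CkBound κ r (b h))
    (c1 : ℝ) (hq : ∀ h, 0 < h → h ≤ hm → ∀ x, max (-(h⁻¹ * (b h x - g x))) 0 * κ x ≤ c1)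
    (hΓ : ∀ h : ℕ → ℝ, (∀ n, 0 < h n) → (∀ n, h n ≤ hm) → Tendsto h atTop (𝓝 0) → ∀ x,
      gammaLimsup (fun n y => uppGen S g y - (((h n)⁻¹ * (b (h n) y - g y) : ℝ) : EReal)) x ≤ 0)
    (x : X) (ε : ℝ) (hε : 0 < ε) (v : ℝ) (hv : S τ (ecoe g) x = (v : EReal)) :
    ∃ h, 0 < h ∧ h ≤ hm ∧ ((v - ε * h : ℝ) : EReal) ≤ S (τ - h) (ecoe (b h)) x := by
  by_contra! hcon
  have hτ0 : 0 < τ := by linarith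
  obtain ⟨hgC, hgS, hgsg, h₀, hh₀, c, hc, hcl⟩ := hg
  set Sg : ℝ → X → ℝ := fun t y => (S t (ecoe g) y).toReal with hSgdef
  have hSg : ∀ t, 0 ≤ t → S t (ecoe g) = ecoe (Sg t) := by
    intro t ht
    obtain ⟨w, -, hw⟩ := hgS t ht
    funext y
    simp only [ecoe, hSgdef, hw y, EReal.toReal_coe]
  have hSgC : ∀ t, 0 ≤ t → MemCk κ (Sg t) := by
    intro t ht
    obtain ⟨w, hw1, hw⟩ := hgS t ht
    have : Sg t = w := by funext y; simp only [hSgdef, hw y, EReal.toReal_coe]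
    rw [this]; exact hw1
  set F : ℝ → ℝ := fun t => Sg t x with hF
  have hFv : F τ = v := by simp only [hF, hSgdef, hv, EReal.toReal_coe]
  have hFS : ∀ t, 0 ≤ t → S t (ecoe g) x = (F t : EReal) := fun t ht => by rw [hSg t ht]; rfl
  have hup : ∀ k, 0 ≤ k → k ≤ h₀ → ∀ y, (Sg k y - g y) * κ y ≤ c * k := by
    intro k hk0 hk1 y
    have h1 := hcl k hk0 hk1 y
    rw [hSg k hk0] at h1
    have p : (0 : EReal) ≤ (κ y : EReal) := by exact_mod_cast (hκ y).le
    have h2 := (mul_le_mul_of_nonneg_right (le_max_left (ecoe (Sg k) y - (g y : EReal)) 0) p).trans h1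
    simp only [ecoe] at h2
    exact_mod_cast h2
  have hd : ∀ k, 0 < k → ∀ y, diffQuot S g k y = ((k⁻¹ * (Sg k y - g y) : ℝ) : EReal) := by
    intro k hk y
    simp only [diffQuot, hSg k hk.le, ecoe]
    push_cast; rfl
  have hdle : ∀ k, 0 < k → k ≤ h₀ → ∀ y, k⁻¹ * (Sg k y - g y) ≤ c / κ y := by
    intro k hk hk1 y
    rw [le_div_iff₀ (hκ y), mul_assoc, inv_mul_le_iff₀ hk]
    linarith [hup k hk.le hk1 y]
  have hAle : ∀ y, At S g y ≤ ((c / κ y : ℝ) : EReal) := by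
    refine envl_le_of (At_mono S g) (memCk_div hκc hκ c).1 hh₀ fun y => iSup₂_le fun k hk => ?_
    rw [hd k hk.1 y]
    exact EReal.coe_le_coe_iff.2 (hdle k hk.1 hk.2.le y)
  have hc1 : 0 ≤ c1 := by
    refine le_trans ?_ (hq hm hhm le_rfl x)
    exact mul_nonneg (le_max_right _ _) (hκ x).le
  set q : ℝ → X → ℝ := fun h y => h⁻¹ * (b h y - g y) with hqdef
  have hqge : ∀ h, 0 < h → h ≤ hm → ∀ y, -(c1 / κ y) ≤ q h y := by
    intro h h1 h2 y
    have := (mul_le_mul_of_nonneg_right (le_max_left (-(q h y)) 0) (hκ y).le).trans (hq h h1 h2 y)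
    rw [← le_div_iff₀ (hκ y)] at this
    linarith
  -- the real valued generator
  set G : X → ℝ := fun y => (max (At S g y) ((-(c1 / κ y) : ℝ) : EReal)).toReal with hGdef
  have hcc : ∀ y, -(c1 / κ y) ≤ c / κ y := fun y => by
    have := div_nonneg hc1 (hκ y).le
    have := div_nonneg hc (hκ y).le
    linarith
  have hGe : ∀ y, (G y : EReal) = max (At S g y) ((-(c1 / κ y) : ℝ) : EReal) := by
    intro y
    refine EReal.coe_toReal ?_ ?_
    · exact ((max_le (hAle y) (EReal.coe_le_coe_iff.2 (hcc y))).trans_lt (EReal.coe_lt_top _)).ne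
    · exact ((EReal.bot_lt_coe _).trans_le (le_max_right _ _)).ne'
  have hGle : ∀ y, G y ≤ c / κ y := by
    intro y
    rw [← EReal.coe_le_coe_iff, hGe]
    exact max_le (hAle y) (EReal.coe_le_coe_iff.2 (hcc y))
  have hAG : ∀ y, At S g y ≤ (G y : EReal) := fun y => by rw [hGe]; exact le_max_left _ _
  have hGusc : UpperSemicontinuous G := by
    have h1 : UpperSemicontinuous fun y => max (At S g y) ((-(c1 / κ y) : ℝ) : EReal) := by
      refine UpperSemicontinuous.sup (envl_usc (At_mono S g)) ?_
      exact (continuous_coe_real_ereal.comp (memCk_div hκc hκ c1).1.neg).upperSemicontinuous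
    intro y w hw
    have h2 := h1 y (w : EReal) (by
      show max (At S g y) ((-(c1 / κ y) : ℝ) : EReal) < (w : EReal)
      rw [← hGe]; exact EReal.coe_lt_coe_iff.2 hw)
    filter_upwards [h2] with z hz
    change max (At S g z) ((-(c1 / κ z) : ℝ) : EReal) < (w : EReal) at hz
    rw [← hGe] at hz
    exact EReal.coe_lt_coe_iff.1 hz
  have hGR : RU κ G := ⟨hGusc, c, hc, fun y => (le_div_iff₀ (hκ y)).1 (hGle y)⟩
  set e : ℝ → X → ℝ := fun h y => max (G y - q h y) 0 with hedef
  have hele : ∀ h, 0 < h → h ≤ hm → ∀ y, e h y ≤ (c + c1) / κ y := by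
    intro h h1 h2 y
    refine max_le ?_ (div_nonneg (by positivity) (hκ y).le)
    rw [add_div]
    linarith [hGle y, hqge h h1 h2 y]
  have heR : ∀ h, 0 < h → h ≤ hm → RU κ (e h) := by
    intro h h1 h2
    refine ⟨?_, c + c1, by positivity, fun y => (le_div_iff₀ (hκ y)).1 (hele h h1 h2 y)⟩
    refine UpperSemicontinuous.sup ?_ upperSemicontinuous_const
    have hqc : Continuous (q h) := ((hbC h h1 h2).1.sub hgC.1).const_mul _
    simp only [sub_eq_add_neg]
    exact hGusc.add hqc.neg.upperSemicontinuous
  -- bounds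
  obtain ⟨C1, hC1, hC1b⟩ := s4 hκ hS (2 * |r|) τ hτ0.le x
  set M : ℝ := max 1 ((3 * C1 + 1) / ε) with hM
  have hM1 : 1 ≤ M := le_max_left _ _
  have hM0 : 0 < M := by linarith
  have hM2 : 3 * C1 + 1 ≤ M * ε := by
    have := le_max_right 1 ((3 * C1 + 1) / ε)
    rwa [div_le_iff₀ hε] at this
  -- the error term
  have hE : ∃ h1, 0 < h1 ∧ h1 ≤ hm ∧ h1 ≤ 1 ∧ ∀ h, 0 < h → h ≤ h1 →
      S (τ - h) (ecoe fun y => 2 * M * e h y) x ≤ ((1:ℝ) : EReal) := by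
    by_contra! hno
    have hn : ∀ n : ℕ, ∃ h, 0 < h ∧ h ≤ min (min hm 1) (1 / ((n:ℝ) + 1)) ∧
        ((1:ℝ) : EReal) < S (τ - h) (ecoe fun y => 2 * M * e h y) x := by
      intro n
      refine hno _ (lt_min (lt_min hhm one_pos) (by positivity)) ?_ ?_
      · exact (min_le_left _ _).trans (min_le_left _ _)
      · exact (min_le_left _ _).trans (min_le_right _ _)
    choose h hh0 hhle hh using hn
    have hhm' : ∀ n, h n ≤ hm := fun n => (hhle n).trans ((min_le_left _ _).trans (min_le_left _ _))
    have hh1 : Tendsto h atTop (𝓝 0) :=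
      squeeze_zero (fun n => (hh0 n).le) (fun n => (hhle n).trans (min_le_right _ _))
        tendsto_one_div_add_atTop_nhds_zero_nat
    have hlim : Tendsto (fun n => τ - h n) atTop (𝓝 τ) := by
      simpa using hh1.const_sub τ
    have h0U : MemUk κ (fun _ : X => (0 : EReal)) :=
      memUk_of_le hκ upperSemicontinuous_const le_rfl (fun y => by simp)
    have ev := gamma_lemma (t := τ) (x := x) (c := ((1:ℝ) : EReal)) hκc hκ hS
      (f := fun n => ecoe fun y => 2 * M * e (h n) y) (F := fun _ => (0 : EReal))
      (r := 2 * M * (c + c1)) (τ := fun n => τ - h n)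
      (fun n => ((heR _ (hh0 n) (hhm' n)).smul (by positivity)).memUk hκ) h0U (by positivity)
      (fun n y => EReal.coe_le_coe_iff.2 (by
        rw [mul_div_assoc]
        exact mul_le_mul_of_nonneg_left (hele _ (hh0 n) (hhm' n) y) (by positivity)))
      ?_ (fun n => by linarith [hhm' n]) hτ0.le hlim
      (by rw [hS.zero τ hτ0.le x]; exact_mod_cast one_pos)
    · obtain ⟨n, hn⟩ := ev.exists
      exact absurd hn (not_lt.2 (hh n).le)
    · intro z w hw
      obtain ⟨w', hw0, hw'⟩ := ereal_between (a := 0) (by exact_mod_cast hw)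
      have hpos : 0 < w' / (2 * M) := by positivity
      obtain ⟨δ, hδ, N, hN⟩ := gamma_local (c := ((w' / (2 * M) : ℝ) : EReal))
        ((hΓ h hh0 hhm' hh1 z).trans_lt (by exact_mod_cast hpos))
      refine ⟨δ, hδ, N, fun n hn y hy => le_trans (EReal.coe_le_coe_iff.2 ?_) hw'.le⟩
      have h3 : uppGen S g y - ((q (h n) y : ℝ) : EReal) ≤ ((w' / (2 * M) : ℝ) : EReal) := hN n hn y hy
      have h4 : uppGen S g y ≤ ((w' / (2 * M) + q (h n) y : ℝ) : EReal) := by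
        rw [EReal.sub_le_iff_le_add (Or.inl (EReal.coe_ne_bot _)) (Or.inl (EReal.coe_ne_top _))] at h3
        exact_mod_cast h3
      have h5 : G y ≤ w' / (2 * M) + q (h n) y := by
        rw [← EReal.coe_le_coe_iff, hGe]
        refine max_le ((At_le_uppGen S g y).trans h4) (EReal.coe_le_coe_iff.2 ?_)
        linarith [hqge _ (hh0 n) (hhm' n) y]
      have h6 : e (h n) y ≤ w' / (2 * M) := max_le (by linarith) hpos.le
      calc 2 * M * e (h n) y ≤ 2 * M * (w' / (2 * M)) :=
            mul_le_mul_of_nonneg_left h6 (by positivity)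
        _ = w' := by field_simp
  obtain ⟨h1, hh1, hh1m, hh11, hE⟩ := hE
  have hgR : RU κ g := hgC.ru hκ
  -- Claim B
  have hB : ∀ h, 0 < h → h ≤ h1 →
      S (τ - h) (ecoe fun y => g y + h * G y) x < ((F τ - ε / 2 * h : ℝ) : EReal) := by
    intro h hh0 hhle
    have hhm' : h ≤ hm := hhle.trans hh1m
    have hτh : 0 ≤ τ - h := by linarith
    have hbh := hbC h hh0 hhm'
    have hb1 : CkBound κ (2 * |r|) (b h) := fun y => by
      have := hbr h hh0 hhm' y
      linarith [le_abs_self r, abs_nonneg r]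
    have hb2 : CkBound κ (2 * |r|) (fun y => 2 * b h y) := fun y => by
      have := hbr h hh0 hhm' y
      rw [abs_mul, abs_two]
      linarith [le_abs_self r]
    obtain ⟨v1, hv1, hv1b⟩ := hC1b (τ - h) hτh (by linarith) _ hbh hb1
    obtain ⟨v2, hv2, hv2b⟩ := hC1b (τ - h) hτh (by linarith) _ (hbh.smul 2) hb2
    have heh := heR h hh0 hhm'
    have hbeR : RU κ (fun y => b h y + M * e h y) := (hbh.ru hκ).add (heh.smul hM0.le)
    have s1 := conv_le hκ hS hτh ((hbh.smul 2).ru hκ)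
      (heh.smul (by positivity : 0 ≤ 2 * M)) hbeR (l := 1 / 2) (by norm_num) (by norm_num)
      (fun y => by nlinarith) (hv2.le) (hE h hh0 hhle)
    have hl1 : h / M ≤ 1 := by rw [div_le_one hM0]; linarith
    have s2 := conv_le hκ hS hτh hbeR (hbh.ru hκ) (hgR.add (hGR.smul hh0.le))
      (l := h / M) (by positivity) hl1 (fun y => by
        have e1 : h / M * (b h y + M * e h y) + (1 - h / M) * b h y = b h y + h * e h y := by
          field_simp; ring
        rw [e1]
        have e2 : h * q h y = b h y - g y := by simp only [hqdef]; field_simp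
        have e3 : G y - q h y ≤ e h y := le_max_left _ _
        nlinarith) s1 hv1.le
    refine s2.trans_lt (EReal.coe_lt_coe_iff.2 ?_)
    have hc0 := hcon h hh0 hhm'
    rw [hv1, EReal.coe_lt_coe_iff] at hc0
    rw [hFv]
    have a1 := abs_le.1 hv1b
    have a2 := abs_le.1 hv2b
    have e4 : h / M * (1 / 2 * v2 + (1 - 1 / 2) * 1) + (1 - h / M) * v1
        = v1 + h / M * (1 / 2 * v2 + 1 / 2 - v1) := by ring
    rw [e4]
    have e5 : h / M * (1 / 2 * v2 + 1 / 2 - v1) ≤ h / M * (M * ε / 2) :=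
      mul_le_mul_of_nonneg_left (by linarith) (by positivity)
    have e6 : h / M * (M * ε / 2) = ε / 2 * h := by field_simp
    linarith
  -- Lipschitz bound
  obtain ⟨rg, hrg⟩ := hgC.2
  obtain ⟨C3, hC3, hC3b⟩ := s4 hκ hS (|rg| + c) τ hτ0.le x
  refine aux_real F τ h1 (2 * C3) (min h₀ 1) (ε / 2) hh1 (lt_min hh₀ one_pos) (half_pos hε) ?_ ?_
  · intro s s' hs1 hs2 hs3 hs4
    have hs0 : 0 ≤ s := by linarith
    set k := s' - s with hk
    have hk0 : 0 ≤ k := by linarith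
    have hk1 : k ≤ 1 := hs4.trans (min_le_right _ _)
    have hkh : k ≤ h₀ := hs4.trans (min_le_left _ _)
    have hCg : MemCk κ (fun y => g y + c / κ y) := hgC.add hκ (memCk_div hκc hκ c)
    obtain ⟨v1, hv1, hv1b⟩ := hC3b s hs0 (by linarith) _ hgC
      (fun y => by linarith [hrg y, le_abs_self rg])
    obtain ⟨v2, hv2, hv2b⟩ := hC3b s hs0 (by linarith) _ hCg (fun y => by
      have p := mul_le_mul_of_nonneg_right (abs_add_le (g y) (c / κ y)) (hκ y).le
      have p2 : |c / κ y| * κ y = c := by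
        rw [abs_of_nonneg (div_nonneg hc (hκ y).le), div_mul_cancel₀ _ (hκ y).ne']
      linarith [hrg y, le_abs_self rg])
    have s1 := conv_le hκ hS hs0 (hCg.ru hκ) hgR ((hSgC k hk0).ru hκ) hk0 hk1 (fun y => by
      have p := hup k hk0 hkh y
      rw [← le_div_iff₀ (hκ y)] at p
      have : c * k / κ y = k * (c / κ y) := by ring
      linarith) hv2.le hv1.le
    rw [← hSg k hk0, ← hgsg s k hs0 hk0, hFS _ (by linarith), EReal.coe_le_coe_iff] at s1
    rw [hFS s hs0, EReal.coe_eq_coe_iff] at hv1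
    have e1 : s + k = s' := by rw [hk]; ring
    rw [e1] at s1
    rw [hv1]
    have a1 := abs_le.1 hv1b
    have a2 := abs_le.1 hv2b
    nlinarith
  · intro h hh0 hhle δ hδ
    have hr0 : 0 ≤ τ - h := by linarith
    set Y := F τ - ε / 2 * h with hY
    set k0 := min δ (min h₀ h) / 2 with hk0
    have hk00 : 0 < k0 := half_pos (lt_min hδ (lt_min hh₀ hh0))
    have hk01 : k0 < δ ∧ k0 < h₀ ∧ k0 < h := by
      have a1 : min δ (min h₀ h) ≤ δ := min_le_left _ _
      have a2 : min δ (min h₀ h) ≤ h₀ := (min_le_right _ _).trans (min_le_left _ _)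
      have a3 : min δ (min h₀ h) ≤ h := (min_le_right _ _).trans (min_le_right _ _)
      refine ⟨?_, ?_, ?_⟩ <;> linarith
    set k : ℕ → ℝ := fun n => k0 * (1 / ((n:ℝ) + 1)) with hk
    have hkpos : ∀ n, 0 < k n := fun n => by simp only [hk]; positivity
    have hkle : ∀ n, k n ≤ k0 := fun n => by
      have : 1 / ((n:ℝ) + 1) ≤ 1 := by
        rw [div_le_one (by positivity)]; linarith [Nat.cast_nonneg (α := ℝ) n]
      simp only [hk]; nlinarith
    have hkt : Tendsto k atTop (𝓝 0) := by
      simpa [hk] using (tendsto_one_div_add_atTop_nhds_zero_nat (𝕜 := ℝ)).const_mul k0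
    have hfC : ∀ n, MemCk κ (fun y => g y + h * ((k n)⁻¹ * (Sg (k n) y - g y))) := by
      intro n
      have h1 := (((hSgC (k n) (hkpos n).le).add hκ (hgC.smul (-1))).smul (k n)⁻¹).smul h
      have h2 := hgC.add hκ h1
      convert h2 using 3
      ring
    have ev := gamma_lemma (t := τ - h) (x := x) (c := ((Y:ℝ) : EReal)) hκc hκ hS
      (f := fun n => ecoe fun y => g y + h * ((k n)⁻¹ * (Sg (k n) y - g y)))
      (F := ecoe fun y => g y + h * G y)
      (r := |rg| + h * c) (τ := fun _ => τ - h)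
      (fun n => ((hfC n).ru hκ).memUk hκ) ((hgR.add (hGR.smul hh0.le)).memUk hκ) (by positivity)
      (fun n y => EReal.coe_le_coe_iff.2 (by
        have p1 := hdle (k n) (hkpos n) (by linarith [hkle n]) y
        have p2 : g y ≤ |rg| / κ y := by
          rw [le_div_iff₀ (hκ y)]
          have := mul_le_mul_of_nonneg_right (le_abs_self (g y)) (hκ y).le
          linarith [hrg y, le_abs_self rg]
        rw [add_div, mul_div_assoc]
        have := mul_le_mul_of_nonneg_left p1 hh0.le
        linarith))
      ?_ (fun n => hr0) hr0 tendsto_const_nhds (hB h hh0 hhle)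
    · obtain ⟨n, hn⟩ := ev.exists
      refine ⟨k n, hkpos n, by linarith [hkle n], ?_⟩
      have hl1 : k n / h ≤ 1 := by rw [div_le_one hh0]; linarith [hkle n]
      have s1 := conv_le hκ hS hr0 ((hfC n).ru hκ) hgR ((hSgC (k n) (hkpos n).le).ru hκ)
        (l := k n / h) (div_nonneg (hkpos n).le hh0.le) hl1 (fun y => by
          have := (hkpos n).ne'
          refine le_of_eq ?_
          field_simp
          ring) hn.le (hFS _ hr0).le
      rw [← hSg _ (hkpos n).le, ← hgsg _ _ hr0 (hkpos n).le,
        hFS _ (by linarith [hkpos n]), EReal.coe_le_coe_iff] at s1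
      have e1 : k n * ((F τ - F (τ - h)) / h - ε / 2) = k n / h * (Y - F (τ - h)) := by
        simp only [hY]; field_simp; ring
      rw [e1]
      linarith
    · intro z w hw
      obtain ⟨w1, hw1, hw1'⟩ := ereal_between (a := g z + h * G z) hw
      set w2 := (G z + (w1 - g z) / h) / 2 with hw2
      have a0 : G z < (w1 - g z) / h := by rw [lt_div_iff₀ hh0]; linarith
      have a1 : G z < w2 := by linarith
      have a2 : w2 < (w1 - g z) / h := by linarith
      rw [lt_div_iff₀ hh0] at a2
      obtain ⟨δ1, hδ1, w3, hw3, hloc⟩ := envl_lt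
        ((hAG z).trans_lt (EReal.coe_lt_coe_iff.2 a1))
      have hgn : ∀ᶠ y in 𝓝 z, g y < w1 - w2 * h :=
        hgC.1.continuousAt.eventually (gt_mem_nhds (by linarith))
      obtain ⟨δ2, hδ2, hgn⟩ := Metric.eventually_nhds_iff_ball.1 hgn
      obtain ⟨N, hN⟩ := eventually_atTop.1 (hkt.eventually (gt_mem_nhds hδ1))
      refine ⟨min δ1 δ2, lt_min hδ1 hδ2, N, fun n hn y hy =>
        le_trans (EReal.coe_le_coe_iff.2 ?_) hw1'.le⟩
      have b1 := hloc y (Metric.ball_subset_ball (min_le_left _ _) hy)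
      have b2 := hgn y (Metric.ball_subset_ball (min_le_right _ _) hy)
      have b3 : diffQuot S g (k n) y ≤ (w2 : EReal) :=
        ((le_iSup₂ (f := fun k (_ : k ∈ Set.Ioo (0:ℝ) δ1) => diffQuot S g k y) (k n)
          ⟨hkpos n, hN n hn⟩).trans b1).trans hw3.le
      rw [hd _ (hkpos n), EReal.coe_le_coe_iff] at b3
      have := mul_le_mul_of_nonneg_left b3 hh0.le
      linarith

/-- comparison principle — `S(t)f` is dominated by every
`Γ`-supersolution. -/
theorem stmt14
    {X : Type*} [MetricSpace X] [CompleteSpace X] [TopologicalSpace.SeparableSpace X]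
    (κ : X → ℝ) (hκc : Continuous κ) (hκpos : ∀ x, 0 < κ x) (hκbd : ∃ C, ∀ x, κ x ≤ C)
    (S : ℝ → (X → EReal) → (X → EReal)) (hS : AssumptionS κ S)
    (T₁ T₂ : ℝ) (hT1 : 0 ≤ T₁) (hT12 : T₁ ≤ T₂)
    (f : X → ℝ) (hf : UpperLip κ S f)
    (u : ℝ → X → ℝ)
    (huLip : ∀ t ∈ Set.Icc T₁ T₂, UpperLip κ S (u t))
    (hinit : ∀ x, S T₁ (ecoe f) x ≤ ((u T₁ x : ℝ) : EReal))
    (hubd : ∃ r : ℝ, ∀ t ∈ Set.Icc T₁ T₂, CkBound κ r (u t))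
    (husc : ∀ t ∈ Set.Icc T₁ T₂, ∀ s : ℕ → ℝ, (∀ n, s n ∈ Set.Icc T₁ T₂) →
      Tendsto s atTop (𝓝 t) →
      ∀ x, gammaLimsup (fun n => ecoe (u (s n))) x ≤ ((u t x : ℝ) : EReal))
    (hcomp : ∀ t, T₁ ≤ t → t < T₂ → ∃ c : ℝ, ∃ h₀ > (0:ℝ),
      ∀ h, 0 < h → h ≤ h₀ → t + h ≤ T₂ →
        ∀ x, max (-(h⁻¹ * (u (t + h) x - u t x))) 0 * κ x ≤ c)
    (hcomp2 : ∀ t, T₁ ≤ t → t < T₂ → ∀ h : ℕ → ℝ, (∀ n, 0 < h n) → (∀ n, t + h n ≤ T₂) →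
      Tendsto h atTop (𝓝 (0:ℝ)) →
      ∀ x, gammaLimsup
        (fun n y => uppGen S (u t) y - (((h n)⁻¹ * (u (t + h n) y - u t y) : ℝ) : EReal)) x ≤ 0) :
    ∀ t ∈ Set.Icc T₁ T₂, ∀ x, S t (ecoe f) x ≤ ((u t x : ℝ) : EReal) := by
  intro t ht x
  obtain ⟨r, hr⟩ := hubd
  have hR : ∀ s ∈ Set.Icc T₁ T₂, MemUk κ (ecoe (u s)) :=
    fun s hs => ((huLip s hs).1.ru hκpos).memUk hκpos
  set v : ℝ → ℝ := fun s => (S (t - s) (ecoe (u s)) x).toReal with hv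
  have hvS : ∀ s, T₁ ≤ s → s ≤ t → S (t - s) (ecoe (u s)) x = (v s : EReal) := by
    intro s h1 h2
    obtain ⟨w, -, hw⟩ := (huLip s ⟨h1, h2.trans ht.2⟩).2.1 (t - s) (by linarith)
    simp only [hv, hw x, EReal.toReal_coe]
  have hvt : v t = u t x := by
    simp only [hv, sub_self, hS.idZero _ (hR t ht), ecoe, EReal.toReal_coe]
  have hv1 : S t (ecoe f) x ≤ (v T₁ : EReal) := by
    rw [← hvS T₁ le_rfl ht.1]
    have e : S t (ecoe f) = S (t - T₁) (S T₁ (ecoe f)) := by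
      rw [← hf.2.2.1 (t - T₁) T₁ (by linarith [ht.1]) hT1]
      congr 1; ring
    rw [e]
    exact hS.monotone _ (by linarith [ht.1]) _ _
      (hS.maps T₁ hT1 _ ((hf.1.ru hκpos).memUk hκpos)) (hR T₁ ⟨le_rfl, hT12⟩) hinit x
  refine hv1.trans (EReal.coe_le_coe_iff.2 ?_)
  rw [← hvt]
  have main : ∀ ε > 0, v T₁ + ε * T₁ ≤ v t + ε * t := by
    intro ε hε
    refine aux_mono (fun s => v s + ε * s) T₁ t ht.1 ?_ ?_
    · intro s hs1 hs2
      have hsT : s < T₂ := hs2.trans_le ht.2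
      have hsI : s ∈ Set.Icc T₁ T₂ := ⟨hs1, hsT.le⟩
      obtain ⟨c, h₀, hh₀, hq⟩ := hcomp s hs1 hsT
      have hp : 0 < t - s := by linarith
      obtain ⟨h, hh1, hh2, hh3⟩ := key_step hκc hκpos hS (u s) (huLip s hsI) (t - s)
        (min h₀ (t - s)) (lt_min hh₀ hp) (min_le_right _ _) (fun h => u (s + h)) r
        (fun h p1 p2 => (huLip (s + h)
          ⟨by linarith, by linarith [p2.trans (min_le_right _ _), ht.2]⟩).1)
        (fun h p1 p2 => hr (s + h)
          ⟨by linarith, by linarith [p2.trans (min_le_right _ _), ht.2]⟩)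
        c (fun h p1 p2 => hq h p1 (p2.trans (min_le_left _ _))
          (by linarith [p2.trans (min_le_right _ _), ht.2]))
        (fun h p1 p2 p3 => hcomp2 s hs1 hsT h p1
          (fun n => by linarith [(p2 n).trans (min_le_right _ _), ht.2]) p3)
        x ε hε (v s) (hvS s hs1 hs2.le)
      have hht := hh2.trans (min_le_right _ _)
      refine ⟨s + h, by linarith, by linarith, ?_⟩
      have e : t - s - h = t - (s + h) := by ring
      rw [e, hvS (s + h) (by linarith) (by linarith), EReal.coe_le_coe_iff] at hh3
      linarith
    · intro s hs1 hs2 sn hn1 hn2 hsn c hc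
      have hsI : s ∈ Set.Icc T₁ T₂ := ⟨hs1, hs2.trans ht.2⟩
      have hnI : ∀ n, sn n ∈ Set.Icc T₁ T₂ := fun n => ⟨hn1 n, ((hn2 n).trans hs2).trans ht.2⟩
      refine le_of_forall_pos_le_add fun η hη => ?_
      have ev := gamma_lemma (t := t - s) (x := x) (c := ((v s + η : ℝ) : EReal)) hκc hκpos hS
        (f := fun n => ecoe (u (sn n))) (F := ecoe (u s)) (r := |r|) (τ := fun n => t - sn n)
        (fun n => hR _ (hnI n)) (hR s hsI) (abs_nonneg r)
        (fun n y => EReal.coe_le_coe_iff.2 (by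
          rw [le_div_iff₀ (hκpos y)]
          have := mul_le_mul_of_nonneg_right (le_abs_self (u (sn n) y)) (hκpos y).le
          linarith [hr _ (hnI n) y, le_abs_self r]))
        (fun z w hw => gamma_local ((husc s hsI sn hnI hsn z).trans_lt hw))
        (fun n => by linarith [hn2 n]) (by linarith) (hsn.const_sub t)
        (by rw [hvS s hs1 hs2]; exact EReal.coe_lt_coe_iff.2 (by linarith))
      have hlim : Tendsto (fun n => v s + η + ε * sn n) atTop (𝓝 (v s + η + ε * s)) :=
        (hsn.const_mul ε).const_add _
      have : c ≤ v s + η + ε * s := by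
        refine ge_of_tendsto hlim ?_
        filter_upwards [ev] with n hn
        rw [hvS _ (hn1 n) ((hn2 n).trans hs2), EReal.coe_lt_coe_iff] at hn
        have := hc n
        linarith
      linarith
  refine le_of_forall_pos_le_add fun η hη => ?_
  have hp : 0 ≤ t - T₁ := by linarith [ht.1]
  have := main (η / (t - T₁ + 1)) (by positivity)
  have e : η / (t - T₁ + 1) * (t - T₁) ≤ η := by
    rw [div_mul_eq_mul_div, div_le_iff₀ (by positivity)]
    nlinarith
  linarith
end

section
/- Let X be a separable Banach space, κ : X → (0,∞) bounded continuous with c_κ := sup_{x∈X} sup_{‖y‖≤1} κ(x)/κ(x−y) < ∞, and let (μ_n) be a sequence of Borel probability measures on X with μ_n({y : ‖y‖ > 1/n}) = 0 for all n. Then: (i) for every n, the convolution map f ↦ f*μ_n is well defined from U_κ to U_κ; (ii) for every sequence (f_m) ⊂ U_κ bounded above, Γ-limsup_{m→∞} (f_m * μ_n) ≤ (Γ-limsup_{m→∞} f_m) * μ_n pointwise; (iii) Γ-limsup_{n→∞} (f * μ_n) ≤ f pointwise for every f ∈ U_κ. -/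
open Filter MeasureTheory Topology
open scoped ENNReal Topology

noncomputable section

/-- extended integral -/
def s16int {X : Type*} [MeasurableSpace X] (μ : Measure X) (F : X → EReal) : EReal :=
  ((∫⁻ y, erealToENNReal (max (F y) 0) ∂μ : ℝ≥0∞) : EReal) -
  ((∫⁻ y, erealToENNReal (max (-F y) 0) ∂μ : ℝ≥0∞) : EReal)

theorem s16_toENNReal (x : EReal) : erealToENNReal x = x.toENNReal := rfl

theorem s16int_mono {X : Type*} [MeasurableSpace X] (μ : Measure X) {F G : X → EReal}
    (h : ∀ᵐ y ∂μ, F y ≤ G y) : s16int μ F ≤ s16int μ G := by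
  unfold s16int
  refine EReal.sub_le_sub ?_ ?_
  · rw [EReal.coe_ennreal_le_coe_ennreal_iff]
    refine lintegral_mono_ae ?_
    filter_upwards [h] with y hy
    exact EReal.toENNReal_le_toENNReal (max_le_max hy le_rfl)
  · rw [EReal.coe_ennreal_le_coe_ennreal_iff]
    refine lintegral_mono_ae ?_
    filter_upwards [h] with y hy
    exact EReal.toENNReal_le_toENNReal (max_le_max (EReal.neg_le_neg_iff.2 hy) le_rfl)

theorem s16_pt (M : ℝ) (hM : 0 ≤ M) (L : ℝ≥0∞) :
    erealToENNReal (max ((M : EReal) - (L : EReal)) 0) + L =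
      ENNReal.ofReal M + erealToENNReal (max (-((M : EReal) - (L : EReal))) 0) := by
  simp only [s16_toENNReal]
  induction L using ENNReal.recTopCoe with
  | top => simp
  | coe l =>
    have h1 : (((l : ℝ≥0∞)) : EReal) = (((l : ℝ)) : EReal) := rfl
    have h2 : ((l : ℝ≥0∞)) = ENNReal.ofReal (l : ℝ) := by simp
    rw [h1, h2, ← EReal.coe_sub, ← EReal.coe_neg, ← EReal.coe_zero,
      ← EReal.coe_strictMono.monotone.map_max, ← EReal.coe_strictMono.monotone.map_max,
      EReal.toENNReal_of_ne_top (EReal.coe_ne_top _),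
      EReal.toENNReal_of_ne_top (EReal.coe_ne_top _), EReal.toReal_coe, EReal.toReal_coe,
      ← ENNReal.ofReal_add (by positivity) (by positivity),
      ← ENNReal.ofReal_add (by positivity) (by positivity)]
    congr 1
    rcases le_total M l with h | h
    · rw [max_eq_right (by linarith), max_eq_left (by linarith)]; ring
    · rw [max_eq_left (by linarith), max_eq_right (by linarith)]; ring

theorem s16_arith (M : ℝ) (hM : 0 ≤ M) (a b I : ℝ≥0∞) (ha : a ≤ ENNReal.ofReal M)
    (h : a + I = ENNReal.ofReal M + b) : (a : EReal) - b = (M : EReal) - I := by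
  have ha' : a ≠ ⊤ := ne_top_of_le_ne_top ENNReal.ofReal_ne_top ha
  lift a to NNReal using ha'
  induction I using ENNReal.recTopCoe with
  | top =>
    have hb : b = ⊤ := by
      by_contra hb
      rw [add_top] at h
      exact (ENNReal.add_ne_top.2 ⟨ENNReal.ofReal_ne_top, hb⟩) h.symm
    subst hb
    simp
  | coe i =>
    have hb : b ≠ ⊤ := by
      rintro rfl
      rw [add_top] at h
      exact (ENNReal.add_ne_top.2 ⟨ENNReal.coe_ne_top, ENNReal.coe_ne_top⟩) h
    lift b to NNReal using hb
    have h' := congrArg ENNReal.toReal h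
    rw [ENNReal.toReal_add (by simp) (by simp), ENNReal.toReal_add (by simp) (by simp),
      ENNReal.toReal_ofReal hM] at h'
    simp only [ENNReal.coe_toReal] at h'
    change (((a:ℝ)) : EReal) - (((b:ℝ)) : EReal) = (M : EReal) - (((i:ℝ)) : EReal)
    rw [← EReal.coe_sub, ← EReal.coe_sub]
    congr 1
    linarith

theorem s16int_sub {X : Type*} [MeasurableSpace X] (μ : Measure X) [IsProbabilityMeasure μ]
    (M : ℝ) (hM : 0 ≤ M) (L : X → ℝ≥0∞) (hL : AEMeasurable L μ) :
    s16int μ (fun y => (M : EReal) - (L y : EReal)) = (M : EReal) - ((∫⁻ y, L y ∂μ : ℝ≥0∞) : EReal) := by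
  unfold s16int
  refine s16_arith M hM _ _ _ ?_ ?_
  · calc _ ≤ ∫⁻ y, ENNReal.ofReal M ∂μ := by
          refine lintegral_mono fun y => ?_
          have h : max ((M : EReal) - (L y : EReal)) 0 ≤ (M : EReal) := by
            refine max_le ?_ (by exact_mod_cast hM)
            calc (M : EReal) - (L y : EReal) ≤ (M : EReal) - 0 :=
                  EReal.sub_le_sub le_rfl (EReal.coe_ennreal_nonneg _)
              _ = M := by simp
          have := EReal.toENNReal_le_toENNReal h
          simpa [s16_toENNReal, EReal.toENNReal_of_ne_top (EReal.coe_ne_top _)] using this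
      _ = _ := by simp
  · rw [← lintegral_add_right' _ hL]
    simp_rw [s16_pt M hM]
    rw [lintegral_add_left measurable_const]
    simp

theorem s16_limsup_sub (M : ℝ) (u : ℕ → ℝ≥0∞) :
    limsup (fun m => (M : EReal) - (u m : EReal)) atTop = (M : EReal) - ((liminf u atTop : ℝ≥0∞) : EReal) := by
  have hanti : Antitone (fun a : ℝ≥0∞ => (M : EReal) - (a : EReal)) := fun a b hab =>
    EReal.sub_le_sub le_rfl (EReal.coe_ennreal_le_coe_ennreal_iff.2 hab)
  have hc : Continuous (fun a : ℝ≥0∞ => (M : EReal) - (a : EReal)) := by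
    rw [continuous_iff_continuousAt]
    intro a
    simp only [sub_eq_add_neg]
    have h1 : ContinuousAt (fun p : EReal × EReal => p.1 + p.2) ((M : EReal), -(a : EReal)) :=
      EReal.continuousAt_add (Or.inl (EReal.coe_ne_top _)) (Or.inl (EReal.coe_ne_bot _))
    have h2 : ContinuousAt (fun a : ℝ≥0∞ => ((M : EReal), -(a : EReal))) a :=
      (continuous_const.prodMk (continuous_neg.comp continuous_coe_ennreal_ereal)).continuousAt
    exact ContinuousAt.comp (f := fun a : ℝ≥0∞ => ((M : EReal), -(a : EReal))) h1 h2
  exact (hanti.map_liminf_of_continuousAt u hc.continuousAt).symm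

theorem s16_cancel (M : ℝ) (F : EReal) (h : F ≤ M) :
    (M : EReal) - ((erealToENNReal (M - F) : ℝ≥0∞) : EReal) = F := by
  have h0 : (0 : EReal) ≤ M - F := by
    rw [EReal.sub_nonneg (Or.inl (EReal.coe_ne_top _)) (Or.inl (EReal.coe_ne_bot _))]; exact h
  rw [s16_toENNReal, EReal.coe_toENNReal h0]
  induction F with
  | bot => simp
  | top => simp at h
  | coe F => rw [← EReal.coe_sub, ← EReal.coe_sub]; congr 1; ring

/-- reverse Fatou -/
theorem s16_fatou {X : Type*} [MeasurableSpace X] (μ : Measure X) [IsProbabilityMeasure μ]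
    (M : ℝ) (hM : 0 ≤ M) (F : ℕ → X → EReal) (hF : ∀ m, Measurable (F m))
    (hb : ∀ᶠ m in atTop, ∀ᵐ y ∂μ, F m y ≤ M) :
    limsup (fun m => s16int μ (F m)) atTop ≤ s16int μ (fun y => limsup (fun m => F m y) atTop) := by
  set G : ℕ → X → ℝ≥0∞ := fun m y => erealToENNReal ((M : EReal) - F m y) with hG
  have hGm : ∀ m, Measurable (G m) := fun m => by
    have : Measurable fun y => (M : EReal) - F m y := by
      simp only [sub_eq_add_neg]
      exact measurable_const.add (hF m).neg
    exact this.ereal_toENNReal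
  have e1 : limsup (fun m => s16int μ (F m)) atTop
      = limsup (fun m => (M : EReal) - ((∫⁻ y, G m y ∂μ : ℝ≥0∞) : EReal)) atTop := by
    refine limsup_congr ?_
    filter_upwards [hb] with m hm
    rw [← s16int_sub μ M hM (G m) (hGm m).aemeasurable]
    apply le_antisymm <;> refine s16int_mono μ ?_ <;> filter_upwards [hm] with y hy
    · exact (s16_cancel M _ hy).ge
    · exact (s16_cancel M _ hy).le
  rw [e1, s16_limsup_sub]
  have hae : ∀ᵐ y ∂μ, ∀ᶠ m in atTop, F m y ≤ M := by
    obtain ⟨N, hN⟩ := eventually_atTop.1 hb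
    have : ∀ᵐ y ∂μ, ∀ m, N ≤ m → F m y ≤ M := by
      rw [ae_all_iff]; intro m
      by_cases h : N ≤ m
      · filter_upwards [hN m h] with y hy _ using hy
      · exact Eventually.of_forall fun y h' => absurd h' h
    filter_upwards [this] with y hy
    exact eventually_atTop.2 ⟨N, hy⟩
  calc (M : EReal) - ((liminf (fun m => ∫⁻ y, G m y ∂μ) atTop : ℝ≥0∞) : EReal)
      ≤ (M : EReal) - ((∫⁻ y, liminf (fun m => G m y) atTop ∂μ : ℝ≥0∞) : EReal) :=
        EReal.sub_le_sub le_rfl (EReal.coe_ennreal_le_coe_ennreal_iff.2 (lintegral_liminf_le hGm))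
    _ = s16int μ (fun y => (M : EReal) - ((liminf (fun m => G m y) atTop : ℝ≥0∞) : EReal)) :=
        (s16int_sub μ M hM _ (Measurable.liminf hGm).aemeasurable).symm
    _ ≤ _ := by
        refine s16int_mono μ ?_
        filter_upwards [hae] with y hy
        rw [← s16_limsup_sub]
        refine (limsup_congr ?_).le
        filter_upwards [hy] with m hm
        exact s16_cancel M _ hm

theorem s16int_const {X : Type*} [MeasurableSpace X] (μ : Measure X) [IsProbabilityMeasure μ]
    (c : ℝ) : s16int μ (fun _ => (c : EReal)) = c := by
  have h := s16int_sub μ (max c 0) (le_max_right _ _) (fun _ => ENNReal.ofReal (max c 0 - c))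
    aemeasurable_const
  have h2 : ((max c 0 : ℝ) : EReal) - ((ENNReal.ofReal (max c 0 - c) : ℝ≥0∞) : EReal) = (c : EReal) := by
    rw [EReal.coe_ennreal_ofReal, max_eq_left (sub_nonneg.2 (le_max_left c 0)), ← EReal.coe_sub]
    congr 1; ring
  simp only [lintegral_const, measure_univ, mul_one, h2] at h
  exact h

theorem s16_bound (f : EReal) (k r : ℝ) (hk : 0 < k) (h : max f 0 * (k : EReal) ≤ r) :
    f ≤ ((r / k : ℝ) : EReal) ∧ 0 ≤ r := by
  have h0 : (0 : EReal) ≤ max f 0 * (k : EReal) :=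
    mul_nonneg (le_max_right _ _) (by exact_mod_cast hk.le)
  have hr : 0 ≤ r := by exact_mod_cast h0.trans h
  refine ⟨?_, hr⟩
  induction f with
  | bot => exact bot_le
  | top =>
    rw [max_eq_left le_top, EReal.top_mul_coe_of_pos hk] at h
    simp at h
  | coe f =>
    rw [← EReal.coe_zero, ← EReal.coe_strictMono.monotone.map_max, ← EReal.coe_mul] at h
    rw [EReal.coe_le_coe_iff] at h ⊢
    rw [le_div_iff₀ hk]
    exact (mul_le_mul_of_nonneg_right (le_max_left f 0) hk.le).trans h

theorem s16_usc_limsup {X : Type*} [TopologicalSpace X] {f : X → EReal}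
    (hf : UpperSemicontinuous f) {x : X} {u : ℕ → X} (hu : Tendsto u atTop (𝓝 x)) :
    limsup (fun m => f (u m)) atTop ≤ f x := by
  refine le_of_forall_gt_imp_ge_of_dense fun c hc => ?_
  refine limsup_le_of_le (by isBoundedDefault) ?_
  filter_upwards [hu.eventually (hf x c hc)] with m hm using hm.le

/-- uniform bound -/
theorem s16_shift {X : Type*} [NormedAddCommGroup X] {κ : X → ℝ} (hκpos : ∀ x, 0 < κ x)
    {c : ℝ} (hc : ∀ x y : X, ‖y‖ ≤ 1 → κ x / κ (x - y) ≤ c)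
    {f : X → EReal} {r : ℝ} (hr : ∀ x, max (f x) 0 * (κ x : EReal) ≤ (r : EReal))
    (x y : X) (hy : ‖y‖ ≤ 1) : f (x - y) ≤ ((r * c / κ x : ℝ) : EReal) := by
  obtain ⟨h1, h2⟩ := s16_bound _ _ _ (hκpos (x - y)) (hr (x - y))
  refine h1.trans (EReal.coe_le_coe_iff.2 ?_)
  have h3 := hc x y hy
  rw [div_le_iff₀ (hκpos _)] at h3
  rw [div_le_div_iff₀ (hκpos _) (hκpos _)]
  nlinarith [mul_le_mul_of_nonneg_left h3 h2]

theorem s16_ball {X : Type*} [NormedAddCommGroup X] [MeasurableSpace X] {μ : Measure X} {n : ℕ}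
    (h : μ {y : X | 1 / (n : ℝ) < ‖y‖} = 0) : ∀ᵐ y ∂μ, ‖y‖ ≤ 1 / (n : ℝ) := by
  rw [ae_iff]; simpa only [not_le] using h

theorem s16_seq {X : Type*} [NormedAddCommGroup X] [MeasurableSpace X] [BorelSpace X]
    {κ : X → ℝ} (hκc : Continuous κ) (hκpos : ∀ x, 0 < κ x)
    {c : ℝ} (hc : ∀ x y : X, ‖y‖ ≤ 1 → κ x / κ (x - y) ≤ c)
    {μ : Measure X} [IsProbabilityMeasure μ] (hμ : ∀ᵐ y ∂μ, ‖y‖ ≤ 1)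
    {f : ℕ → X → EReal} (hf : ∀ m, UpperSemicontinuous (f m)) {r : ℝ}
    (hr : ∀ m x, max (f m x) 0 * (κ x : EReal) ≤ (r : EReal))
    {x : X} {u : ℕ → X} (hu : Tendsto u atTop (𝓝 x)) :
    limsup (fun m => econv μ (f m) (u m)) atTop
      ≤ s16int μ (fun y => limsup (fun m => f m (u m - y)) atTop) := by
  have hr0 : 0 ≤ r := (s16_bound _ _ _ (hκpos x) (hr 0 x)).2
  have hc1 : 1 ≤ c := by
    have := hc x 0 (by simp)
    rwa [sub_zero, div_self (hκpos x).ne'] at this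
  have ht : Tendsto (fun m => r * c / κ (u m)) atTop (𝓝 (r * c / κ x)) :=
    Tendsto.div tendsto_const_nhds ((hκc.tendsto x).comp hu) (hκpos x).ne'
  refine s16_fatou μ (r * c / κ x + 1) ?_ (fun m y => f m (u m - y)) (fun m => ?_) ?_
  · have := hκpos x; positivity
  · exact (UpperSemicontinuous.measurable (hf m)).comp (continuous_const.sub continuous_id).measurable
  · filter_upwards [ht.eventually (gt_mem_nhds (lt_add_one _))] with m hm
    filter_upwards [hμ] with y hy
    exact (s16_shift hκpos hc (hr m) (u m) y hy).trans (EReal.coe_le_coe_iff.2 hm.le)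

end

/-- properties of convolution with probability measures concentrating
around zero. -/
theorem stmt16
    {X : Type*} [NormedAddCommGroup X] [NormedSpace ℝ X] [CompleteSpace X]
    [TopologicalSpace.SeparableSpace X] [MeasurableSpace X] [BorelSpace X]
    (κ : X → ℝ) (hκc : Continuous κ) (hκpos : ∀ x, 0 < κ x) (hκbd : ∃ C, ∀ x, κ x ≤ C)
    (hcκ : ∃ c : ℝ, ∀ x y : X, ‖y‖ ≤ 1 → κ x / κ (x - y) ≤ c)
    (μ : ℕ → Measure X) (hprob : ∀ n, IsProbabilityMeasure (μ n))
    (hsupp : ∀ n : ℕ, 1 ≤ n → μ n {y : X | 1 / (n : ℝ) < ‖y‖} = 0) :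
    (∀ n : ℕ, 1 ≤ n → ∀ f : X → EReal, MemUk κ f → MemUk κ (econv (μ n) f)) ∧
    (∀ n : ℕ, 1 ≤ n → ∀ fm : ℕ → X → EReal, (∀ m, MemUk κ (fm m)) →
      (∃ r : ℝ, ∀ m x, max (fm m x) 0 * (κ x : EReal) ≤ (r : EReal)) →
      ∀ x, gammaLimsup (fun m => econv (μ n) (fm m)) x ≤ econv (μ n) (gammaLimsup fm) x) ∧
    (∀ f : X → EReal, MemUk κ f →
      ∀ x, gammaLimsup (fun n => econv (μ n) f) x ≤ f x) := by
  obtain ⟨c, hc⟩ := hcκ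
  have hball : ∀ n : ℕ, 1 ≤ n → ∀ᵐ y ∂(μ n), ‖y‖ ≤ 1 := fun n hn => by
    filter_upwards [s16_ball (hsupp n hn)] with y hy
    refine hy.trans ?_
    rw [div_le_one (by exact_mod_cast hn)]
    exact_mod_cast hn
  refine ⟨?_, ?_, ?_⟩
  · rintro n hn f ⟨hf, hft, r, hr⟩
    have hB : ∀ x, econv (μ n) f x ≤ ((r * c / κ x : ℝ) : EReal) := fun x => by
      rw [← s16int_const (μ n) (r * c / κ x)]
      refine s16int_mono (F := fun y => f (x - y)) (μ n) ?_
      filter_upwards [hball n hn] with y hy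
      exact s16_shift hκpos hc hr x y hy
    have hc1 : 1 ≤ c := by
      have := hc 0 0 (by simp)
      rwa [sub_zero, div_self (hκpos 0).ne'] at this
    have hr0 : 0 ≤ r := (s16_bound _ _ _ (hκpos 0) (hr 0)).2
    refine ⟨?_, fun x => (hB x).trans_lt (EReal.coe_lt_top _), r * c, fun x => ?_⟩
    · intro x a ha
      by_contra hcon
      obtain ⟨u, hu, hu2⟩ := exists_seq_forall_of_frequently
        (Filter.not_eventually.1 hcon)
      have h1 := s16_seq hκc hκpos hc (hball n hn) (f := fun _ => f) (fun _ => hf)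
        (fun _ => hr) hu
      have h2 : s16int (μ n) (fun y => limsup (fun m => f (u m - y)) atTop) ≤ econv (μ n) f x :=
        s16int_mono (G := fun y => f (x - y)) (μ n)
          (Eventually.of_forall fun y => s16_usc_limsup hf (hu.sub_const y))
      have h3 : a ≤ limsup (fun m => econv (μ n) f (u m)) atTop :=
        le_limsup_of_frequently_le (Frequently.of_forall fun m => not_lt.1 (hu2 m))
          (by isBoundedDefault)
      exact absurd ha (not_lt.2 (h3.trans (h1.trans h2)))
    · have hk := hκpos x
      have h0 : max (econv (μ n) f x) 0 ≤ ((r * c / κ x : ℝ) : EReal) :=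
        max_le (hB x) (by
          have : 0 ≤ r * c / κ x := by positivity
          exact_mod_cast this)
      calc _ ≤ ((r * c / κ x : ℝ) : EReal) * (κ x : EReal) :=
            mul_le_mul_of_nonneg_right h0 (by exact_mod_cast hk.le)
        _ = _ := by
            rw [← EReal.coe_mul, div_mul_cancel₀ _ hk.ne']
  · rintro n hn fm hfm ⟨r, hr⟩ x
    refine iSup₂_le fun u hu => ?_
    refine (s16_seq hκc hκpos hc (hball n hn) (fun m => (hfm m).1) hr hu).trans ?_
    refine s16int_mono (G := fun y => gammaLimsup fm (x - y)) (μ n)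
      (Eventually.of_forall fun y => ?_)
    exact le_iSup₂_of_le (fun m => u m - y) (hu.sub_const y) le_rfl
  · rintro f ⟨hf, hft, r, hr⟩ x
    refine iSup₂_le fun u hu => ?_
    refine le_of_forall_gt_imp_ge_of_dense fun a ha => ?_
    obtain ⟨b, hb1, hb2⟩ := EReal.lt_iff_exists_real_btwn.1 ha
    refine le_trans ?_ hb2.le
    refine limsup_le_of_le (by isBoundedDefault) ?_
    obtain ⟨δ, hδ, hδb⟩ := Metric.eventually_nhds_iff.1 (hf x b hb1)
    have h1 : ∀ᶠ n : ℕ in atTop, dist (u n) x < δ / 2 :=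
      hu.eventually (Metric.ball_mem_nhds x (half_pos hδ))
    have h2 : ∀ᶠ n : ℕ in atTop, 1 / (n : ℝ) < δ / 2 :=
      tendsto_one_div_atTop_nhds_zero_nat.eventually (gt_mem_nhds (half_pos hδ))
    filter_upwards [h1, h2, eventually_ge_atTop 1] with n hn1 hn2 hn3
    rw [← s16int_const (μ n) b]
    refine s16int_mono (F := fun y => f (u n - y)) (μ n) ?_
    filter_upwards [s16_ball (hsupp n hn3)] with y hy
    refine (hδb ?_).le
    rw [dist_eq_norm] at hn1 ⊢
    calc ‖u n - y - x‖ = ‖(u n - x) - y‖ := by congr 1; abel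
      _ ≤ ‖u n - x‖ + ‖y‖ := norm_sub_le _ _
      _ < δ := by linarith
end
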